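/- (Unbiasedness of GSURE) Let Y be a random vector in ℝ^d whose distribution has density p(y; θ) = h(y)·exp(⟨y, θ⟩ − A(θ)) with respect to Lebesgue measure on ℝ^d. Let θ̂ : ℝ^d → ℝ^d be continuously differentiable with bounded partial derivatives, and assume h and ∇h are continuously differentiable with the required integrability and decay-at-infinity conditions. Define GSURE(Y) = ‖θ̂(Y)‖² + 2⟨∇h(Y)/h(Y), θ̂(Y)⟩ + 2·tr(∂θ̂/∂y)(Y) + (1/h(Y))·tr(∂²h/∂y²)(Y), where ∂²h/∂y² is the Hessian of h. Then E[GSURE(Y)] = E‖θ − θ̂(Y)‖². -/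

import Mathlib

open MeasureTheory Filter

section Cutoff

variable {E : Type*} [NormedAddCommGroup E] [NormedSpace ℝ E]

theorem contDiff_fderiv_apply_const {n m : ℕ∞} {g : E → ℝ} (hg : ContDiff ℝ n g)
    (hmn : m + 1 ≤ n) (v : E) : ContDiff ℝ m (fun y => fderiv ℝ g y v) :=
  (hg.fderiv_right (by exact_mod_cast hmn)).clm_apply contDiff_const

theorem continuous_fderiv_apply_const {g : E → ℝ} (hg : ContDiff ℝ 1 g) (v : E) :
    Continuous (fun y => fderiv ℝ g y v) :=
  (hg.continuous_fderiv one_ne_zero).clm_apply continuous_const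

theorem HasCompactSupport.comp_const_smul {φ : E → ℝ} (hφ : HasCompactSupport φ) {c : ℝ}
    (hc : c ≠ 0) : HasCompactSupport (fun y => φ (c • y)) :=
  hφ.comp_homeomorph (Homeomorph.smulOfNeZero c hc)

theorem fderiv_comp_const_smul_apply (φ : E → ℝ) (c : ℝ) (v : E) :
    (fun y => fderiv ℝ (fun z => φ (c • z)) y v) = fun y => c * fderiv ℝ φ (c • y) v := by
  ext y
  rw [fderiv_comp_smul]
  simp

variable [MeasurableSpace E] (μ : Measure E)

theorem tendsto_mul_integral_comp_smul_mul_zero {ψ g : E → ℝ} (hψ : Continuous ψ)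
    (hc : HasCompactSupport ψ) (hg : Integrable g μ) {r : ℕ → ℝ}
    (hr : Tendsto r atTop (nhds 0)) :
    Tendsto (fun n => r n * ∫ y, ψ (r n • y) * g y ∂μ) atTop (nhds 0) := by
  obtain ⟨C, hC⟩ := hψ.bounded_above_of_compact_support hc
  have hlim : Tendsto (fun n => |r n| * ∫ y, C * ‖g y‖ ∂μ) atTop (nhds 0) := by
    simpa using hr.abs.mul_const (∫ y, C * ‖g y‖ ∂μ)
  refine squeeze_zero_norm (fun n => ?_) hlim
  rw [norm_mul, Real.norm_eq_abs]
  refine mul_le_mul_of_nonneg_left ?_ (abs_nonneg _)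
  refine norm_integral_le_of_norm_le (hg.norm.const_mul C) (ae_of_all _ fun y => ?_)
  rw [norm_mul]
  exact mul_le_mul_of_nonneg_right (hC _) (norm_nonneg _)

variable [FiniteDimensional ℝ E] [BorelSpace E] [μ.IsAddHaarMeasure]

theorem integral_mul_fderiv_eq_neg_of_hasCompactSupport {φ g : E → ℝ}
    (hφ : ContDiff ℝ 1 φ) (hc : HasCompactSupport φ) (hg : ContDiff ℝ 1 g) (v : E) :
    ∫ y, φ y * fderiv ℝ g y v ∂μ = - ∫ y, fderiv ℝ φ y v * g y ∂μ := by
  have hφ' := continuous_fderiv_apply_const hφ v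
  have hg' := continuous_fderiv_apply_const hg v
  apply integral_mul_fderiv_eq_neg_fderiv_mul_of_integrable
  · exact (hφ'.mul hg.continuous).integrable_of_hasCompactSupport (hc.fderiv_apply ℝ v).mul_right
  · exact (hφ.continuous.mul hg').integrable_of_hasCompactSupport hc.mul_right
  · exact (hφ.continuous.mul hg.continuous).integrable_of_hasCompactSupport hc.mul_right
  · exact fun y _ => hφ.differentiable one_ne_zero y
  · exact fun y _ => hg.differentiable one_ne_zero y

theorem tendsto_integral_cutoff_mul_fderiv {φ g : E → ℝ} (hφ : ContDiff ℝ 1 φ)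
    (hc : HasCompactSupport φ) (hg : ContDiff ℝ 1 g) (hgi : Integrable g μ) (v : E)
    {r : ℕ → ℝ} (hr : Tendsto r atTop (nhds 0)) (hr0 : ∀ n, r n ≠ 0) :
    Tendsto (fun n => ∫ y, φ (r n • y) * fderiv ℝ g y v ∂μ) atTop (nhds 0) := by
  have hlim := (tendsto_mul_integral_comp_smul_mul_zero μ (continuous_fderiv_apply_const hφ v)
    (hc.fderiv_apply ℝ v) hgi hr).neg
  rw [neg_zero] at hlim
  refine hlim.congr fun n => ?_
  rw [integral_mul_fderiv_eq_neg_of_hasCompactSupport μ (φ := fun y => φ (r n • y))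
    (hφ.comp (contDiff_const_smul (r n))) (hc.comp_const_smul (hr0 n)) hg v,
    ← integral_const_mul]
  simp_rw [congrFun (fderiv_comp_const_smul_apply φ (r n) v), mul_assoc]

theorem tendsto_integral_cutoff_mul_fderiv_fderiv {φ g : E → ℝ} (hφ : ContDiff ℝ 2 φ)
    (hc : HasCompactSupport φ) (hg : ContDiff ℝ 2 g) (hgi : Integrable g μ) (v : E)
    {r : ℕ → ℝ} (hr : Tendsto r atTop (nhds 0)) (hr0 : ∀ n, r n ≠ 0) :
    Tendsto (fun n => ∫ y, φ (r n • y) * fderiv ℝ (fun z => fderiv ℝ g z v) y v ∂μ)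
      atTop (nhds 0) := by
  have hφ' : ContDiff ℝ 1 (fun y => fderiv ℝ φ y v) :=
    contDiff_fderiv_apply_const (n := 2) (m := 1) hφ (by norm_num) v
  have hg' : ContDiff ℝ 1 (fun y => fderiv ℝ g y v) :=
    contDiff_fderiv_apply_const (n := 2) (m := 1) hg (by norm_num) v
  have hlim := (hr.mul (tendsto_integral_cutoff_mul_fderiv μ hφ' (hc.fderiv_apply ℝ v)
    (hg.of_le one_le_two) hgi v hr hr0)).neg
  rw [mul_zero, neg_zero] at hlim
  refine hlim.congr fun n => ?_
  rw [integral_mul_fderiv_eq_neg_of_hasCompactSupport μ (φ := fun y => φ (r n • y))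
    ((hφ.of_le one_le_two).comp (contDiff_const_smul (r n))) (hc.comp_const_smul (hr0 n)) hg' v,
    ← integral_const_mul]
  simp_rw [congrFun (fderiv_comp_const_smul_apply φ (r n) v), mul_assoc]

theorem integral_sum_fderiv_add_fderiv_fderiv_eq_zero {ι : Type*} [Fintype ι] (v : ι → E)
    {q : ι → E → ℝ} {g : E → ℝ} (hq : ∀ i, ContDiff ℝ 1 (q i)) (hqi : ∀ i, Integrable (q i) μ)
    (hg : ContDiff ℝ 2 g) (hgi : Integrable g μ)
    (hint : Integrable (fun y => ∑ i, (fderiv ℝ (q i) y (v i)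
      + fderiv ℝ (fun z => fderiv ℝ g z (v i)) y (v i))) μ) :
    ∫ y, ∑ i, (fderiv ℝ (q i) y (v i)
      + fderiv ℝ (fun z => fderiv ℝ g z (v i)) y (v i)) ∂μ = 0 := by
  let φ : ContDiffBump (0 : E) := ⟨1, 2, one_pos, one_lt_two⟩
  have hφ : ContDiff ℝ 2 φ := φ.contDiff
  have hc : HasCompactSupport φ := φ.hasCompactSupport
  let r : ℕ → ℝ := fun n => 1 / ((n : ℝ) + 1)
  have hr : Tendsto r atTop (nhds 0) := tendsto_one_div_add_atTop_nhds_zero_nat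
  have hr0 : ∀ n, r n ≠ 0 := fun n => by positivity
  have hg' (i : ι) : ContDiff ℝ 1 (fun y => fderiv ℝ g y (v i)) :=
    contDiff_fderiv_apply_const (n := 2) (m := 1) hg (by norm_num) (v i)
  have hφr (n : ℕ) : Continuous fun y => φ (r n • y) := by
    have := hφ.continuous
    fun_prop
  have hlim : Tendsto (fun n => ∫ y, φ (r n • y) * ∑ i, (fderiv ℝ (q i) y (v i)
      + fderiv ℝ (fun z => fderiv ℝ g z (v i)) y (v i)) ∂μ) atTop
      (nhds (∫ y, ∑ i, (fderiv ℝ (q i) y (v i)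
        + fderiv ℝ (fun z => fderiv ℝ g z (v i)) y (v i)) ∂μ)) := by
    refine tendsto_integral_of_dominated_convergence _
      (fun n => (hφr n).aestronglyMeasurable.mul hint.aestronglyMeasurable) hint.norm
      (fun n => ae_of_all _ fun y => ?_) (ae_of_all _ fun y => ?_)
    · rw [norm_mul, Real.norm_of_nonneg φ.nonneg]
      exact mul_le_of_le_one_left (norm_nonneg _) φ.le_one
    · have h0 : φ ((0 : ℝ) • y) = 1 := by
        rw [zero_smul]
        exact φ.one_of_mem_closedBall (by simp [φ])
      have := ((hφ.continuous.tendsto _).comp (hr.smul_const y)).mul_const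
        (∑ i, (fderiv ℝ (q i) y (v i) + fderiv ℝ (fun z => fderiv ℝ g z (v i)) y (v i)))
      rwa [h0, one_mul] at this
  refine tendsto_nhds_unique hlim ?_
  have hzero := tendsto_finsetSum (Finset.univ : Finset ι) fun i _ =>
    (tendsto_integral_cutoff_mul_fderiv μ (hφ.of_le one_le_two) hc (hq i) (hqi i) (v i) hr
      hr0).add (tendsto_integral_cutoff_mul_fderiv_fderiv μ hφ hc hg hgi (v i) hr hr0)
  simp only [add_zero, Finset.sum_const_zero] at hzero
  refine hzero.congr fun n => ?_
  have h1 (i : ι) : Integrable (fun y => φ (r n • y) * fderiv ℝ (q i) y (v i)) μ :=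
    ((hφr n).mul (continuous_fderiv_apply_const (hq i) (v i))).integrable_of_hasCompactSupport
      (hc.comp_const_smul (hr0 n)).mul_right
  have h2 (i : ι) : Integrable
      (fun y => φ (r n • y) * fderiv ℝ (fun z => fderiv ℝ g z (v i)) y (v i)) μ :=
    ((hφr n).mul (continuous_fderiv_apply_const (hg' i) (v i))).integrable_of_hasCompactSupport
      (hc.comp_const_smul (hr0 n)).mul_right
  simp_rw [Finset.mul_sum, mul_add]
  exact (Finset.sum_congr rfl fun i _ => (integral_add (h1 i) (h2 i)).symm).trans
    (integral_finsetSum _ fun i _ => (h1 i).add (h2 i)).symm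

/-- The derivative of a differentiable map vanishes at almost every point of its zero set. -/
theorem ae_fderiv_eq_zero_of_eq_zero {F : E → E} (hF : Differentiable ℝ F) :
    ∀ᵐ y ∂μ, F y = 0 → fderiv ℝ F y = 0 := by
  let s : Set E := F ⁻¹' {0}
  have hs : MeasurableSet s := (isClosed_singleton.preimage hF.continuous).measurableSet
  have happrox : ApproximatesLinearOn F (0 : E →L[ℝ] E) s 0 := by
    intro x hx y hy
    simp [show F x = 0 from hx, show F y = 0 from hy]
  have := happrox.norm_fderiv_sub_le μ hs (fderiv ℝ F)
    fun y _ => (hF y).hasFDerivAt.hasFDerivWithinAt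
  filter_upwards [(ae_restrict_iff' hs).1 this] with y hy hy0
  simpa using hy hy0

end Cutoff

section Density

theorem fderiv_exp_sum_mul_sub {ι : Type*} [Fintype ι] [DecidableEq ι] (θ : ι → ℝ) (c : ℝ)
    (i : ι) (y : ι → ℝ) :
    fderiv ℝ (fun y : ι → ℝ => Real.exp ((∑ j, y j * θ j) - c)) y (Pi.single i 1)
      = θ i * Real.exp ((∑ j, y j * θ j) - c) := by
  have hlin : HasFDerivAt (fun y : ι → ℝ => (∑ j, y j * θ j) - c)
      (∑ j, θ j • (ContinuousLinearMap.proj j : (ι → ℝ) →L[ℝ] ℝ)) y :=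
    (HasFDerivAt.fun_sum fun j _ => (hasFDerivAt_apply j y).mul_const (θ j)).sub_const c
  rw [hlin.exp.fderiv]
  simp [Pi.single_apply, mul_comm]

theorem integrable_comp_iff_and_integral_comp_of_map_eq_withDensity {Ω E : Type*}
    [MeasurableSpace Ω] [MeasurableSpace E] {P : Measure Ω} {μ : Measure E} {Y : Ω → E}
    (hY : Measurable Y) {p : E → ℝ} (hp : Measurable p) (hp0 : ∀ y, 0 ≤ p y)
    (hlaw : P.map Y = μ.withDensity fun y => ENNReal.ofReal (p y)) {F : E → ℝ}
    (hF : Measurable F) :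
    (Integrable (fun ω => F (Y ω)) P ↔ Integrable (fun y => p y * F y) μ) ∧
      ∫ ω, F (Y ω) ∂P = ∫ y, p y * F y ∂μ := by
  have hfin : ∀ᵐ y ∂μ, ENNReal.ofReal (p y) < ⊤ := ae_of_all _ fun y => ENNReal.ofReal_lt_top
  constructor
  · have h1 : Integrable (fun ω => F (Y ω)) P ↔ Integrable F (P.map Y) :=
      (integrable_map_measure hF.aestronglyMeasurable hY.aemeasurable).symm
    rw [h1, hlaw, integrable_withDensity_iff_integrable_smul' hp.ennreal_ofReal hfin]
    simp_rw [ENNReal.toReal_ofReal (hp0 _), smul_eq_mul]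
  · rw [← integral_map hY.aemeasurable hF.aestronglyMeasurable, hlaw,
      integral_withDensity_eq_integral_toReal_smul hp.ennreal_ofReal hfin]
    simp_rw [ENNReal.toReal_ofReal (hp0 _), smul_eq_mul]

/-- At almost every zero of a nonnegative `C²` function, the second derivatives vanish. -/
theorem ae_fderiv_fderiv_eq_zero_of_nonneg {d : ℕ} {h : (Fin d → ℝ) → ℝ} (hpos : ∀ y, 0 ≤ h y)
    (hh : ContDiff ℝ 2 h) :
    ∀ᵐ y, h y = 0 → ∀ i,
      fderiv ℝ (fun y => fderiv ℝ h y (Pi.single i 1)) y (Pi.single i 1) = 0 := by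
  let F : (Fin d → ℝ) → (Fin d → ℝ) := fun y i => fderiv ℝ h y (Pi.single i 1)
  have hFi (i : Fin d) : Differentiable ℝ fun y => F y i :=
    (contDiff_fderiv_apply_const (n := 2) (m := 1) hh (by norm_num) _).differentiable one_ne_zero
  have hF : Differentiable ℝ F := differentiable_pi.2 hFi
  filter_upwards [ae_fderiv_eq_zero_of_eq_zero volume hF] with y hy hy0 i
  have hmin : IsLocalMin h y := Eventually.of_forall fun z => hy0 ▸ hpos z
  have hFy : F y = 0 := by
    ext i
    simp [F, hmin.fderiv_eq_zero]
  have := congrArg (fun L : (Fin d → ℝ) →L[ℝ] (Fin d → ℝ) => L (Pi.single i 1) i) (hy hFy)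
  rw [fderiv_pi fun i => hFi i y] at this
  simpa using this

end Density

/-- Unbiasedness of GSURE: for `Y` with density `h(y) exp(⟨y,θ⟩ − A(θ))`
w.r.t. Lebesgue measure on `ℝ^d`, `θ̂` continuously differentiable with bounded partial
derivatives, `h` and `∇h` continuously differentiable, under integrability and
decay-at-infinity conditions,
`E[‖θ̂(Y)‖² + 2⟨∇h(Y)/h(Y), θ̂(Y)⟩ + 2 tr(∂θ̂/∂y)(Y) + (1/h(Y)) tr(∂²h/∂y²)(Y)]
  = E‖θ − θ̂(Y)‖²`. -/
theorem gsure_unbiased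
    {Ω : Type*} [MeasurableSpace Ω] (P : Measure Ω) [IsProbabilityMeasure P]
    (d : ℕ) (θ : Fin d → ℝ) (h : (Fin d → ℝ) → ℝ) (A : (Fin d → ℝ) → ℝ)
    (hpos : ∀ y, 0 ≤ h y) (hh : ContDiff ℝ 2 h)
    (Y : Ω → Fin d → ℝ) (hmeas : Measurable Y)
    (hlaw : P.map Y
      = volume.withDensity (fun y => ENNReal.ofReal (h y * Real.exp ((∑ i, y i * θ i) - A θ))))
    (hatθ : (Fin d → ℝ) → (Fin d → ℝ))
    (hf : ContDiff ℝ 1 hatθ)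
    (hbdd : ∃ C : ℝ, ∀ y i j, |fderiv ℝ hatθ y (Pi.single j 1) i| ≤ C)
    (hint1 : Integrable (fun ω =>
      (∑ i, hatθ (Y ω) i ^ 2)
        + 2 * ∑ i, (fderiv ℝ h (Y ω) (Pi.single i 1) / h (Y ω)) * hatθ (Y ω) i
        + 2 * ∑ i, fderiv ℝ hatθ (Y ω) (Pi.single i 1) i
        + (1 / h (Y ω))
            * ∑ i, fderiv ℝ (fun y => fderiv ℝ h y (Pi.single i 1)) (Y ω) (Pi.single i 1)) P)
    (hint2 : Integrable (fun ω => ∑ i, (θ i - hatθ (Y ω) i) ^ 2) P)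
    (hint3 : ∀ i, Integrable (fun ω => θ i * hatθ (Y ω) i) P)
    (hint4 : ∀ i, Integrable (fun ω => θ i * fderiv ℝ h (Y ω) (Pi.single i 1) / h (Y ω)) P)
    (hdecay1 : ∀ i, Tendsto (fun y : Fin d → ℝ => h y * hatθ y i * Real.exp (∑ j, y j * θ j))
      (cocompact (Fin d → ℝ)) (nhds 0))
    (hdecay2 : Tendsto (fun y : Fin d → ℝ => h y * Real.exp (∑ j, y j * θ j))
      (cocompact (Fin d → ℝ)) (nhds 0))
    (hdecay3 : ∀ i, Tendsto
      (fun y : Fin d → ℝ => fderiv ℝ h y (Pi.single i 1) * Real.exp (∑ j, y j * θ j))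
      (cocompact (Fin d → ℝ)) (nhds 0)) :
    ∫ ω, ((∑ i, hatθ (Y ω) i ^ 2)
        + 2 * ∑ i, (fderiv ℝ h (Y ω) (Pi.single i 1) / h (Y ω)) * hatθ (Y ω) i
        + 2 * ∑ i, fderiv ℝ hatθ (Y ω) (Pi.single i 1) i
        + (1 / h (Y ω))
            * ∑ i, fderiv ℝ (fun y => fderiv ℝ h y (Pi.single i 1)) (Y ω) (Pi.single i 1)) ∂P
      = ∫ ω, ∑ i, (θ i - hatθ (Y ω) i) ^ 2 ∂P := by
  obtain ⟨p, hp_def⟩ : ∃ p : (Fin d → ℝ) → ℝ,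
      p = fun y => h y * Real.exp ((∑ i, y i * θ i) - A θ) := ⟨_, rfl⟩
  have hw : ContDiff ℝ 2 fun y : Fin d → ℝ => Real.exp ((∑ i, y i * θ i) - A θ) := by fun_prop
  have hp : ContDiff ℝ 2 p := hp_def ▸ hh.mul hw
  have hp0 (y) : 0 ≤ p y := by
    rw [hp_def]
    exact mul_nonneg (hpos y) (Real.exp_pos _).le
  have hlaw' : P.map Y = volume.withDensity fun y => ENNReal.ofReal (p y) := by rw [hlaw, hp_def]
  have htransfer {F : (Fin d → ℝ) → ℝ} (hF : Measurable F) :=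
    integrable_comp_iff_and_integral_comp_of_map_eq_withDensity hmeas hp.continuous.measurable hp0
      hlaw' hF
  have hfi (i) : ContDiff ℝ 1 fun y => hatθ y i := contDiff_pi.1 hf i
  have hdh (i) : ContDiff ℝ 1 fun y => fderiv ℝ h y (Pi.single i 1) :=
    contDiff_fderiv_apply_const (n := 2) (m := 1) hh (by norm_num) _
  have hdiv (y i) : fderiv ℝ (fun z => hatθ z i) y (Pi.single i 1)
      = fderiv ℝ hatθ y (Pi.single i 1) i := by
    rw [show hatθ = fun z j => hatθ z j from rfl,
      fderiv_pi fun j => (hfi j).differentiable one_ne_zero y]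
    rfl
  have hdp (i) : (fun y => fderiv ℝ p y (Pi.single i 1)) = fun y =>
      fderiv ℝ h y (Pi.single i 1) * Real.exp ((∑ j, y j * θ j) - A θ) + θ i * p y := by
    ext y
    rw [hp_def, fderiv_fun_mul (hh.differentiable two_ne_zero y) (hw.differentiable two_ne_zero y)]
    simp only [add_apply, smul_apply, smul_eq_mul, fderiv_exp_sum_mul_sub]
    ring
  have hddp (i y) : fderiv ℝ (fun y => fderiv ℝ p y (Pi.single i 1)) y (Pi.single i 1)
      = Real.exp ((∑ j, y j * θ j) - A θ)
          * (fderiv ℝ (fun y => fderiv ℝ h y (Pi.single i 1)) y (Pi.single i 1)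
            + 2 * θ i * fderiv ℝ h y (Pi.single i 1)) + θ i ^ 2 * p y := by
    have hdhi := (hdh i).differentiable one_ne_zero y
    have hwd := hw.differentiable two_ne_zero y
    have hpd := hp.differentiable two_ne_zero y
    rw [hdp i, fderiv_fun_add (hdhi.fun_mul hwd) (hpd.const_mul _), fderiv_fun_mul hdhi hwd,
      fderiv_const_mul hpd]
    simp only [add_apply, smul_apply, smul_eq_mul, fderiv_exp_sum_mul_sub,
      congrFun (hdp i) y]
    ring
  let q : Fin d → (Fin d → ℝ) → ℝ := fun i y => p y * (2 * (hatθ y i - θ i))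
  have hq (i) : ContDiff ℝ 1 (q i) :=
    (hp.of_le one_le_two).mul (contDiff_const.mul ((hfi i).sub contDiff_const))
  have hdq (i y) : fderiv ℝ (q i) y (Pi.single i 1)
      = 2 * (fderiv ℝ h y (Pi.single i 1) * Real.exp ((∑ j, y j * θ j) - A θ) + θ i * p y)
          * (hatθ y i - θ i) + 2 * p y * fderiv ℝ hatθ y (Pi.single i 1) i := by
    have hpd := hp.differentiable two_ne_zero y
    have hfd := (hfi i).differentiable one_ne_zero y
    rw [fderiv_fun_mul hpd ((hfd.sub_const _).const_mul _), fderiv_const_mul (hfd.sub_const _),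
      fderiv_sub_const]
    simp only [add_apply, smul_apply, smul_eq_mul, congrFun (hdp i) y, hdiv]
    ring
  have hpint : Integrable p := by
    simpa using (htransfer (F := fun _ => 1) measurable_const).1.1 (integrable_const 1)
  have hfm (i) : Measurable fun y => hatθ y i := (hfi i).continuous.measurable
  have hqint (i) : Integrable (q i) := by
    have hm : Measurable fun y => 2 * (hatθ y i - θ i) := ((hfm i).sub_const _).const_mul _
    refine (htransfer hm).1.1 ?_
    refine ((integrable_const (1 : ℝ)).add hint2).mono' (hm.comp hmeas).aestronglyMeasurable
      (ae_of_all _ fun ω => ?_)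
    have hle : (θ i - hatθ (Y ω) i) ^ 2 ≤ ∑ j, (θ j - hatθ (Y ω) j) ^ 2 :=
      Finset.single_le_sum (f := fun j => (θ j - hatθ (Y ω) j) ^ 2)
        (fun j _ => sq_nonneg _) (Finset.mem_univ i)
    simp only [Pi.add_apply]
    rw [Real.norm_eq_abs, abs_le]
    constructor <;> nlinarith [sq_nonneg (hatθ (Y ω) i - θ i - 1),
      sq_nonneg (hatθ (Y ω) i - θ i + 1)]
  let D : (Fin d → ℝ) → ℝ := fun y =>
    ((∑ i, hatθ y i ^ 2)
        + 2 * ∑ i, (fderiv ℝ h y (Pi.single i 1) / h y) * hatθ y i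
        + 2 * ∑ i, fderiv ℝ hatθ y (Pi.single i 1) i
        + (1 / h y)
            * ∑ i, fderiv ℝ (fun y => fderiv ℝ h y (Pi.single i 1)) y (Pi.single i 1))
      - ∑ i, (θ i - hatθ y i) ^ 2
  have hD : Measurable D := by
    have hhm : Measurable h := hh.continuous.measurable
    have hdhm (i) : Measurable fun y => fderiv ℝ h y (Pi.single i 1) :=
      (hdh i).continuous.measurable
    have hdfm (i) : Measurable fun y => fderiv ℝ hatθ y (Pi.single i 1) i := by
      simp_rw [← hdiv]
      exact (continuous_fderiv_apply_const (hfi i) _).measurable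
    have hddhm (i) : Measurable fun y =>
        fderiv ℝ (fun y => fderiv ℝ h y (Pi.single i 1)) y (Pi.single i 1) :=
      (continuous_fderiv_apply_const (hdh i) _).measurable
    fun_prop
  have hDae : (fun y => p y * D y) =ᵐ[volume] fun y => ∑ i, (fderiv ℝ (q i) y (Pi.single i 1)
      + fderiv ℝ (fun z => fderiv ℝ p z (Pi.single i 1)) y (Pi.single i 1)) := by
    filter_upwards [ae_fderiv_fderiv_eq_zero_of_nonneg hpos hh] with y hy
    simp only [D, hdq, hddp, Finset.mul_sum, ← Finset.sum_add_distrib, ← Finset.sum_sub_distrib]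
    refine Finset.sum_congr rfl fun i _ => ?_
    rcases eq_or_ne (h y) 0 with h0 | h0
    · have hmin : IsLocalMin h y := Eventually.of_forall fun z => h0 ▸ hpos z
      simp [hp_def, h0, hy h0 i, hmin.fderiv_eq_zero]
    · simp only [hp_def]
      field_simp
      ring
  have hzero := integral_sum_fderiv_add_fderiv_fderiv_eq_zero volume
    (fun i : Fin d => Pi.single i (1 : ℝ)) hq hqint hp hpint
    (((htransfer hD).1.1 (hint1.sub hint2)).congr hDae)
  have hdiff := (htransfer hD).2.trans ((integral_congr_ae hDae).trans hzero)
  exact sub_eq_zero.1 ((integral_sub hint1 hint2).symm.trans hdiff)
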